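/- Let V ∈ ℝ^{C×D} have no zero entries and pairwise distinct entries in its d-th column, let a ∈ ℝ^C, and let x' ∈ ℝ^D with x'_d ≠ 0. Then there exists a class c such that softmax(V x_α + a)_c → 1 as α → ∞. -/

import Mathlib

/-- The softmax function on `ℝ^C`. -/
noncomputable def softmax {C : ℕ} (z : Fin C → ℝ) : Fin C → ℝ :=
  fun c => Real.exp (z c) / ∑ c', Real.exp (z c')

/-- The point `x'` scaled by `α` in coordinate `d` (all other coordinates unchanged). -/
def scaled {D : ℕ} (x' : Fin D → ℝ) (d : Fin D) (α : ℝ) : Fin D → ℝ :=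
  Function.update x' d (α * x' d)

theorem softmax_eq_inv_sum {C : ℕ} (z : Fin C → ℝ) (c : Fin C) :
    softmax z c = (∑ c', Real.exp (z c' - z c))⁻¹ := by
  simp only [softmax, Real.exp_sub, ← Finset.sum_div, inv_div]

theorem tendsto_softmax_one {C : ℕ} {ι : Type*} {l : Filter ι} (z : ι → Fin C → ℝ) (c : Fin C)
    (h : ∀ c' ≠ c, Filter.Tendsto (fun i => z i c' - z i c) l Filter.atBot) :
    Filter.Tendsto (fun i => softmax (z i) c) l (nhds 1) := by
  have hterm : ∀ c' ∈ Finset.univ, Filter.Tendsto (fun i => Real.exp (z i c' - z i c)) l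
      (nhds (if c' = c then 1 else 0)) := by
    intro c' _
    split_ifs with hc
    · simp [hc, tendsto_const_nhds]
    · exact Real.tendsto_exp_atBot.comp (h c' hc)
  simpa [softmax_eq_inv_sum] using (tendsto_finsetSum _ hterm).inv₀ (by simp)

theorem scaled_eq_add {D : ℕ} (x' : Fin D → ℝ) (d : Fin D) (α : ℝ) :
    scaled x' d α = Function.update x' d 0 + Pi.single d (α * x' d) := by
  ext j
  by_cases hj : j = d
  · subst hj
    simp [scaled]
  · simp [scaled, hj]

theorem mulVec_scaled {C D : ℕ} (V : Matrix (Fin C) (Fin D) ℝ) (x' : Fin D → ℝ) (d : Fin D)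
    (α : ℝ) (c : Fin C) :
    V.mulVec (scaled x' d α) c = V.mulVec (Function.update x' d 0) c + α * (V c d * x' d) := by
  rw [scaled_eq_add, Matrix.mulVec_add, Pi.add_apply, Matrix.mulVec_single]
  simp only [Pi.smul_apply, Matrix.col_apply, MulOpposite.smul_eq_mul_unop, MulOpposite.unop_op]
  ring

theorem stmt_3 (D C : ℕ) (hC : 1 ≤ C)
    (V : Matrix (Fin C) (Fin D) ℝ) (a : Fin C → ℝ) (d : Fin D)
    (hV : ∀ c d', V c d' ≠ 0)
    (hcol : Function.Injective fun c => V c d)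
    (x' : Fin D → ℝ) (hx' : x' d ≠ 0) :
    ∃ c : Fin C,
      Filter.Tendsto (fun α : ℝ => softmax (V.mulVec (scaled x' d α) + a) c)
        Filter.atTop (nhds 1) := by
  have : Nonempty (Fin C) := ⟨⟨0, hC⟩⟩
  obtain ⟨c, hc⟩ := Finite.exists_max fun c => V c d * x' d
  refine ⟨c, tendsto_softmax_one _ c fun c' hne => ?_⟩
  have hlt : V c' d * x' d - V c d * x' d < 0 :=
    sub_neg.2 ((hc c').lt_of_ne fun h => hne (hcol (mul_right_cancel₀ hx' h)))
  refine (Filter.tendsto_atBot_add_const_left _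
    (V.mulVec (Function.update x' d 0) c' + a c' - (V.mulVec (Function.update x' d 0) c + a c))
    (Filter.tendsto_id.atTop_mul_const_of_neg hlt)).congr fun α => ?_
  simp only [Pi.add_apply, mulVec_scaled, id_eq]
  ring
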